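/- For every A ∈ ℕ^ℕ there exists an A'-recursive treemap G: ℕ* → ℕ* (on the full tree ℕ*) such that for every X ∈ ℕ^ℕ, X ⊕ A' ≡_T G(X) ⊕ A' ≡_T (G(X) ⊕ A)', uniformly in X; moreover for every e and X, the e-th oracle machine with oracle G(X) ⊕ A halts on input e if and only if it halts within |G(X↾(e+1))| steps using the oracle string G(X↾(e+1)) ⊕ (A restricted accordingly). -/

import Mathlib

namespace Harrington

open scoped Classical

/-- Codes for oracle Turing machines (partial recursive functionals),
    extending `Nat.Partrec.Code` with an `oracle` constructor. -/
inductive OCode : Type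
  | zero : OCode
  | succ : OCode
  | left : OCode
  | right : OCode
  | oracle : OCode
  | pair : OCode → OCode → OCode
  | comp : OCode → OCode → OCode
  | prec : OCode → OCode → OCode
  | rfind' : OCode → OCode

/-- Evaluation of an oracle code relative to a (total) oracle `A`. -/
def evalo (A : ℕ → ℕ) : OCode → ℕ →. ℕ
  | OCode.zero => pure 0
  | OCode.succ => fun n => Part.some (n + 1)
  | OCode.left => fun n => Part.some (Nat.unpair n).1
  | OCode.right => fun n => Part.some (Nat.unpair n).2
  | OCode.oracle => fun n => Part.some (A n)
  | OCode.pair cf cg => fun n => Nat.pair <$> evalo A cf n <*> evalo A cg n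
  | OCode.comp cf cg => fun n => evalo A cg n >>= evalo A cf
  | OCode.prec cf cg =>
    Nat.unpaired fun a n =>
      n.rec (evalo A cf a) fun y IH => do
        let i ← IH
        evalo A cg (Nat.pair a (Nat.pair y i))
  | OCode.rfind' cf =>
    Nat.unpaired fun a m =>
      (Nat.rfind fun n => (fun x => x = 0) <$> evalo A cf (Nat.pair a (n + m))).map (· + m)

/-- The standard enumeration of oracle codes: `OCode.ofNat e` is the `e`-th oracle machine. -/
def OCode.ofNat : ℕ → OCode
  | 0 => OCode.zero
  | 1 => OCode.succ
  | 2 => OCode.left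
  | 3 => OCode.right
  | 4 => OCode.oracle
  | n + 5 =>
    have hm : n.div2.div2 < n + 5 := by
      have h1 : n.div2.div2 ≤ n := by
        simp only [Nat.div2_val]
        exact le_trans (Nat.div_le_self _ _) (Nat.div_le_self _ _)
      omega
    have _m1 : n.div2.div2.unpair.1 < n + 5 := lt_of_le_of_lt (Nat.unpair_left_le _) hm
    have _m2 : n.div2.div2.unpair.2 < n + 5 := lt_of_le_of_lt (Nat.unpair_right_le _) hm
    match n.bodd, n.div2.bodd with
    | false, false => OCode.pair (OCode.ofNat n.div2.div2.unpair.1) (OCode.ofNat n.div2.div2.unpair.2)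
    | false, true  => OCode.comp (OCode.ofNat n.div2.div2.unpair.1) (OCode.ofNat n.div2.div2.unpair.2)
    | true,  false => OCode.prec (OCode.ofNat n.div2.div2.unpair.1) (OCode.ofNat n.div2.div2.unpair.2)
    | true,  true  => OCode.rfind' (OCode.ofNat n.div2.div2)

/-- The Turing jump `A'` of an oracle `A`:  `A'(e) = 1` if the `e`-th machine with
    oracle `A` halts on input `e`, and `A'(e) = 0` otherwise. -/
noncomputable def jump (A : ℕ → ℕ) : ℕ → ℕ :=
  fun e => if (evalo A (OCode.ofNat e) e).Dom then 1 else 0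

/-- Iterated Turing jump `A^{(n)}`. -/
noncomputable def jumpIter (A : ℕ → ℕ) : ℕ → (ℕ → ℕ)
  | 0 => A
  | n + 1 => jump (jumpIter A n)

/-- The constant zero function (the trivial oracle `0`). -/
def zeroF : ℕ → ℕ := fun _ => 0

/-- The `ω`-jump: `X^{(ω)} = {(i,n) : i ∈ X^{(n)}}`, coded via `Nat.pair` and identified
    with its characteristic function. -/
noncomputable def omegaJump (A : ℕ → ℕ) : ℕ → ℕ :=
  fun m => if jumpIter A m.unpair.2 m.unpair.1 ≠ 0 then 1 else 0

/-- The recursive join `A ⊕ B`. -/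
def oplus (A B : ℕ → ℕ) : ℕ → ℕ :=
  fun n => if n % 2 = 0 then A (n / 2) else B (n / 2)

/-- Code `c` computes the total function `f` from oracle `A`. -/
def computesFn (A : ℕ → ℕ) (c : OCode) (f : ℕ → ℕ) : Prop :=
  ∀ n, evalo A c n = Part.some (f n)

/-- Turing reducibility `X ≤_T A` for points of Baire space. -/
def TRedIn (X A : ℕ → ℕ) : Prop := ∃ c : OCode, computesFn A c X

/-- `X` is arithmetical relative to `Y`: `X ≤_T Y^{(n)}` for some `n`. -/
def ArithIn (X Y : ℕ → ℕ) : Prop := ∃ n : ℕ, TRedIn X (jumpIter Y n)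

/-- `X` and `Y` are arithmetically equivalent. -/
def ArithEquiv (X Y : ℕ → ℕ) : Prop := ArithIn X Y ∧ ArithIn Y X

/-! ### Strings and trees -/

/-- Strings: finite sequences of natural numbers. -/
abbrev Str := List ℕ

/-- The initial segment `X↾n` of a point `X` of Baire space. -/
def initSeg (X : ℕ → ℕ) (n : ℕ) : Str := (List.range n).map X

/-- A tree is a set of strings closed under initial segments. -/
def IsTree (T : Set Str) : Prop := ∀ σ τ : Str, σ <+: τ → τ ∈ T → σ ∈ T

/-- `[T]`, the set of paths through `T`. -/
def paths (T : Set Str) : Set (ℕ → ℕ) := {X | ∀ n, initSeg X n ∈ T}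

/-- The characteristic function of a set of strings. -/
noncomputable def chi (T : Set Str) : Str → ℕ := fun σ => if σ ∈ T then 1 else 0

/-- A set of strings is `A`-recursive: its characteristic function is computable from `A`. -/
def SetRecIn (A : ℕ → ℕ) (T : Set Str) : Prop :=
  ∃ c : OCode, ∀ σ : Str, evalo A c (Encodable.encode σ) = Part.some (chi T σ)

/-- `P ⊆ ℕ^ℕ` is `Π^{0,A}_1` : `P = [T]` for some `A`-recursive tree `T`. -/
def IsPi01In (A : ℕ → ℕ) (P : Set (ℕ → ℕ)) : Prop :=
  ∃ T : Set Str, IsTree T ∧ SetRecIn A T ∧ P = paths T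

/-- `P ⊆ ℕ^ℕ` is `Π⁰₁` : `P = [T]` for some recursive tree `T`. -/
def IsPi01 (P : Set (ℕ → ℕ)) : Prop := IsPi01In zeroF P

/-! ### Treemaps -/

/-- `F` is a treemap on the tree `T`: `F(σ⌢⟨i⟩) ⊇ F(σ)⌢⟨i⟩` whenever `σ⌢⟨i⟩ ∈ T`. -/
def IsTreemapOn (T : Set Str) (F : Str → Str) : Prop :=
  ∀ (σ : Str) (i : ℕ), σ ++ [i] ∈ T → (F σ) ++ [i] <+: F (σ ++ [i])

/-- The image tree `F(T) = {τ : ∃ σ ∈ T, τ ⊆ F(σ)}`. -/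
def treeImage (F : Str → Str) (T : Set Str) : Set Str :=
  {τ | ∃ σ ∈ T, τ <+: F σ}

/-- The map on paths induced by a treemap: `X ↦ ⋃ₙ F(X↾n)`. -/
def pathMap (F : Str → Str) (X : ℕ → ℕ) : ℕ → ℕ :=
  fun i => (F (initSeg X (i + 1))).getD i 0

/-- The string function `F` is `A`-recursive on `T` (restriction of a partial
    `A`-recursive function). -/
def FnRecInOn (A : ℕ → ℕ) (F : Str → Str) (T : Set Str) : Prop :=
  ∃ c : OCode, ∀ σ ∈ T, evalo A c (Encodable.encode σ) = Part.some (Encodable.encode (F σ))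

/-- `F` maps `P` homeomorphically onto `Q` (subspace topologies from Baire space). -/
def HomeoOn (F : (ℕ → ℕ) → (ℕ → ℕ)) (P Q : Set (ℕ → ℕ)) : Prop :=
  Set.BijOn F P Q ∧ ContinuousOn F P ∧
    ∃ G : (ℕ → ℕ) → (ℕ → ℕ), Set.InvOn G F P Q ∧ ContinuousOn G Q

/-- `f X ≡_T g X` uniformly for all `X ∈ P`: the Turing reductions are given by
    fixed indices independent of `X`. -/
def UnifEquivOn (P : Set (ℕ → ℕ)) (f g : (ℕ → ℕ) → (ℕ → ℕ)) : Prop :=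
  ∃ c d : OCode, ∀ X ∈ P, computesFn (g X) c (f X) ∧ computesFn (f X) d (g X)

/-! ### Standard enumerations -/

/-- `W_e^A`: the `e`-th `A`-recursively enumerable set of strings. -/
def WA (A : ℕ → ℕ) (e : ℕ) : Set Str :=
  {σ | (evalo A (OCode.ofNat e) (Encodable.encode σ)).Dom}

/-- `T_e^A = {σ : ∀ n ≤ |σ|, σ↾n ∉ W_e^A}`: the standard enumeration of `Π^{0,A}_1` trees. -/
def TA (A : ℕ → ℕ) (e : ℕ) : Set Str :=
  {σ | ∀ n ≤ σ.length, σ.take n ∉ WA A e}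

/-- `P_e^A = [T_e^A]`: the standard enumeration of `Π^{0,A}_1` subsets of Baire space. -/
def PA (A : ℕ → ℕ) (e : ℕ) : Set (ℕ → ℕ) := paths (TA A e)

/-! ### The arithmetical hierarchy on Baire space -/

/-- Prepend a number to a point of Baire space. -/
def consF (k : ℕ) (X : ℕ → ℕ) : ℕ → ℕ := fun i => Nat.casesOn i k fun j => X j

/-- `Σ⁰ₙ` subsets of Baire space.  `Σ⁰₀` sets are the recursive clopen sets
    (depending computably on a fixed finite initial segment), and
    `Σ⁰ₙ₊₁` sets are obtained from `Π⁰ₙ` sets by existential number quantification. -/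
def SigmaN : ℕ → Set (ℕ → ℕ) → Prop
  | 0, P => ∃ (k : ℕ) (f : Str → Bool), Computable f ∧ P = {X | f (initSeg X k) = true}
  | n + 1, P => ∃ Q : Set (ℕ → ℕ), SigmaN n Qᶜ ∧ P = {X | ∃ k : ℕ, consF k X ∈ Q}

/-- `Π⁰ₙ` subsets of Baire space: complements of `Σ⁰ₙ` sets. -/
def PiN (n : ℕ) (P : Set (ℕ → ℕ)) : Prop := SigmaN n Pᶜ

/-- Arithmetical subsets of Baire space: `Π⁰ₙ` for some `n`. -/
def IsArith (P : Set (ℕ → ℕ)) : Prop := ∃ n : ℕ, PiN n P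


/-- Bounded (`k`-step) evaluation of an oracle code where the oracle is given by a
finite string `σ` (a query `n` succeeds only if `n < |σ|`). -/
def evalno (σ : Str) : ℕ → OCode → ℕ → Option ℕ
  | 0, _ => fun _ => Option.none
  | k + 1, OCode.zero => fun n => do
    guard (n ≤ k)
    return 0
  | k + 1, OCode.succ => fun n => do
    guard (n ≤ k)
    return (Nat.succ n)
  | k + 1, OCode.left => fun n => do
    guard (n ≤ k)
    return n.unpair.1
  | k + 1, OCode.right => fun n => do
    guard (n ≤ k)
    return n.unpair.2
  | k + 1, OCode.oracle => fun n => do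
    guard (n ≤ k)
    σ[n]?
  | k + 1, OCode.pair cf cg => fun n => do
    guard (n ≤ k)
    Nat.pair <$> evalno σ (k + 1) cf n <*> evalno σ (k + 1) cg n
  | k + 1, OCode.comp cf cg => fun n => do
    guard (n ≤ k)
    let x ← evalno σ (k + 1) cg n
    evalno σ (k + 1) cf x
  | k + 1, OCode.prec cf cg => fun n => do
    guard (n ≤ k)
    n.unpaired fun a m =>
      m.casesOn (evalno σ (k + 1) cf a) fun y => do
        let i ← evalno σ k (OCode.prec cf cg) (Nat.pair a y)
        evalno σ (k + 1) cg (Nat.pair a (Nat.pair y i))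
  | k + 1, OCode.rfind' cf => fun n => do
    guard (n ≤ k)
    n.unpaired fun a m => do
      let x ← evalno σ (k + 1) cf (Nat.pair a m)
      if x = 0 then
        pure m
      else
        evalno σ k (OCode.rfind' cf) (Nat.pair a (m + 1))

/-- The join `τ ⊕ (A↾|τ|)` of a string `τ` with (the appropriate restriction of) an
oracle `A`, as a string of length `2|τ|`. -/
def strOplus (τ : Str) (A : ℕ → ℕ) : Str :=
  (List.range (2 * τ.length)).map fun j => if j % 2 = 0 then τ.getD (j / 2) 0 else A (j / 2)

open Nat.Partrec (Code)

/-! ### Oracle codes -/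

/-- An oracle-free code, viewed as an oracle code. -/
def OCode.ofCode : Code → OCode
  | .zero => .zero
  | .succ => .succ
  | .left => .left
  | .right => .right
  | .pair cf cg => .pair (ofCode cf) (ofCode cg)
  | .comp cf cg => .comp (ofCode cf) (ofCode cg)
  | .prec cf cg => .prec (ofCode cf) (ofCode cg)
  | .rfind' cf => .rfind' (ofCode cf)

theorem evalo_ofCode (A : ℕ → ℕ) (c : Code) : evalo A (OCode.ofCode c) = c.eval := by
  induction c <;> simp only [OCode.ofCode, evalo, Code.eval, *] <;> rfl

/-- Replace every oracle query in a code by a call to the code `c`. -/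
def OCode.subst (c : OCode) : OCode → OCode
  | .zero => .zero
  | .succ => .succ
  | .left => .left
  | .right => .right
  | .oracle => c
  | .pair cf cg => .pair (subst c cf) (subst c cg)
  | .comp cf cg => .comp (subst c cf) (subst c cg)
  | .prec cf cg => .prec (subst c cf) (subst c cg)
  | .rfind' cf => .rfind' (subst c cf)

theorem evalo_subst {A B : ℕ → ℕ} {c : OCode} (h : computesFn A c B) (d : OCode) :
    evalo A (c.subst d) = evalo B d := by
  induction d
  case oracle => exact funext h
  all_goals simp only [OCode.subst, evalo, *]; try rfl

/-- An index of an oracle code in the enumeration `OCode.ofNat`. -/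
def OCode.index : OCode → ℕ
  | .zero => 0
  | .succ => 1
  | .left => 2
  | .right => 3
  | .oracle => 4
  | .pair cf cg => 2 * (2 * Nat.pair (index cf) (index cg)) + 5
  | .comp cf cg => 2 * (2 * Nat.pair (index cf) (index cg) + 1) + 5
  | .prec cf cg => (2 * (2 * Nat.pair (index cf) (index cg)) + 1) + 5
  | .rfind' cf => (2 * (2 * index cf + 1) + 1) + 5

theorem OCode.ofNat_index (c : OCode) : OCode.ofNat c.index = c := by
  induction c <;> simp [OCode.index, OCode.ofNat, Nat.div2_val, *]

/-- The oracle code computing the constant function with value `m`. -/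
def OCode.const : ℕ → OCode
  | 0 => .zero
  | m + 1 => .comp .succ (OCode.const m)

theorem evalo_const (A : ℕ → ℕ) (m n : ℕ) : evalo A (OCode.const m) n = Part.some m := by
  induction m with
  | zero => rfl
  | succ m ih => simp [OCode.const, evalo, ih]

theorem computable_index_comp_const (c : OCode) :
    Computable fun m => (OCode.comp c (OCode.const m)).index := by
  have hcomp : ∀ {f g : ℕ → ℕ}, Computable f → Computable g →
      Computable fun m => 2 * (2 * Nat.pair (f m) (g m) + 1) + 5 := fun hf hg =>
    Primrec.to_comp (f := fun n : ℕ => 2 * (2 * n + 1) + 5)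
      (Primrec.nat_add.comp (Primrec.nat_mul.comp (Primrec.const 2)
        (Primrec.succ.comp (Primrec.nat_mul.comp (Primrec.const 2) Primrec.id)))
        (Primrec.const 5)) |>.comp (Primrec₂.natPair.to_comp.comp hf hg)
  have hconst : Computable fun m => (OCode.const m).index := by
    have hs : Computable fun n : ℕ => 2 * (2 * Nat.pair 1 n + 1) + 5 :=
      hcomp (Computable.const 1) Computable.id
    refine (Computable.nat_rec Computable.id (Computable.const 0)
      (hs.comp (Computable.snd.comp Computable.snd)).to₂).of_eq fun m => ?_
    induction m with
    | zero => rfl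
    | succ m ih => exact congrArg (fun n => 2 * (2 * Nat.pair 1 n + 1) + 5) ih
  exact hcomp (Computable.const c.index) hconst

theorem mem_evalo_pair {A : ℕ → ℕ} {cf cg : OCode} {n x : ℕ} :
    x ∈ evalo A (.pair cf cg) n ↔
      ∃ y ∈ evalo A cf n, ∃ z ∈ evalo A cg n, Nat.pair y z = x := by
  simp [evalo, Seq.seq, eq_comm]

theorem mem_evalo_comp {A : ℕ → ℕ} {cf cg : OCode} {n x : ℕ} :
    x ∈ evalo A (.comp cf cg) n ↔ ∃ y ∈ evalo A cg n, x ∈ evalo A cf y :=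
  Part.mem_bind_iff

theorem mem_evalo_prec_zero {A : ℕ → ℕ} {cf cg : OCode} {a x : ℕ} :
    x ∈ evalo A (.prec cf cg) (Nat.pair a 0) ↔ x ∈ evalo A cf a := by
  simp [evalo]

theorem mem_evalo_prec_succ {A : ℕ → ℕ} {cf cg : OCode} {a m x : ℕ} :
    x ∈ evalo A (.prec cf cg) (Nat.pair a (m + 1)) ↔
      ∃ y ∈ evalo A (.prec cf cg) (Nat.pair a m),
        x ∈ evalo A cg (Nat.pair a (Nat.pair m y)) := by
  simp [evalo]

theorem mem_evalo_rfind' {A : ℕ → ℕ} {cf : OCode} {a m x : ℕ} :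
    x ∈ evalo A (.rfind' cf) (Nat.pair a m) ↔
      ∃ y, (0 ∈ evalo A cf (Nat.pair a (y + m)) ∧
        ∀ i < y, ∃ z ∈ evalo A cf (Nat.pair a (i + m)), z ≠ 0) ∧ y + m = x := by
  rw [evalo, Nat.unpaired, Nat.unpair_pair, Part.mem_map_iff]
  refine exists_congr fun y => and_congr_left fun _ => Nat.mem_rfind.trans (and_congr ?_ ?_)
  · exact (Part.mem_map_iff _).trans (by simp)
  · exact forall_congr' fun i => forall_congr' fun _ => (Part.mem_map_iff _).trans (by simp)

/-! ### Replacing the oracle by a finite string -/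

theorem exists_lookup_code :
    ∃ c : Code, ∀ (l : Str) (n : ℕ), c.eval (Nat.pair (Encodable.encode l) n) = (l[n]? : Part ℕ) := by
  have h : Partrec₂ fun (l : Str) (n : ℕ) => (l[n]? : Part ℕ) :=
    Computable.ofOption Primrec.list_getElem?.to_comp
  obtain ⟨c, hc⟩ := Code.exists_code.1 h
  refine ⟨c, fun l n => ?_⟩
  have h2 : Encodable.encode (l, n) = Nat.pair (Encodable.encode l) n := rfl
  rw [hc]
  change (Part.ofOption (Encodable.decode (Nat.pair (Encodable.encode l) n))).bind
    (fun a : Str × ℕ => Part.map Encodable.encode (a.1[a.2]? : Part ℕ)) = _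
  rw [← h2, Encodable.encodek, Part.coe_some, Part.bind_some]
  exact Part.map_id' (fun _ => rfl) _

/-- An oracle-free code for the partial function `(l, n) ↦ l[n]?`. -/
noncomputable def lookupCode : Code := exists_lookup_code.choose

/-- Replace every oracle query in a code by a lookup in the string `l`. -/
noncomputable def OCode.withString (l : Str) : OCode → Code
  | .zero => .zero
  | .succ => .succ
  | .left => .left
  | .right => .right
  | .oracle => Code.curry lookupCode (Encodable.encode l)
  | .pair cf cg => .pair (withString l cf) (withString l cg)
  | .comp cf cg => .comp (withString l cf) (withString l cg)
  | .prec cf cg => .prec (withString l cf) (withString l cg)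
  | .rfind' cf => .rfind' (withString l cf)

theorem eval_withString_oracle (l : Str) (n : ℕ) :
    (OCode.withString l OCode.oracle).eval n = (l[n]? : Part ℕ) := by
  rw [OCode.withString, Code.eval_curry, lookupCode, exists_lookup_code.choose_spec]

theorem evalno_of_evaln {l l' : Str} (hl : ∀ (i x : ℕ), l[i]? = some x → l'[i]? = some x) :
    ∀ {k : ℕ} {c : OCode} {n x : ℕ},
      x ∈ Code.evaln k (c.withString l) n → x ∈ evalno l' k c n
  | 0, c, n, x, h => by simp [Code.evaln] at h
  | k + 1, c, n, x, h => by
    have hguard : ∀ {n x : ℕ} {o₁ o₂ : Option ℕ}, (x ∈ o₁ → x ∈ o₂) →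
        x ∈ (do guard (n ≤ k); o₁) → x ∈ (do guard (n ≤ k); o₂) := by
      simp only [Option.mem_def, bind, Option.bind_eq_some_iff, Option.guard_eq_some',
        exists_and_left, exists_const, and_imp]
      introv h₁ h₂ h₃
      exact ⟨h₂, h₁ h₃⟩
    induction c generalizing x n with
    | zero => rw [OCode.withString, Code.evaln] at h; rw [evalno]; exact hguard id h
    | succ => rw [OCode.withString, Code.evaln] at h; rw [evalno]; exact hguard id h
    | left => rw [OCode.withString, Code.evaln] at h; rw [evalno]; exact hguard id h
    | right => rw [OCode.withString, Code.evaln] at h; rw [evalno]; exact hguard id h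
    | oracle =>
      have hb := Code.evaln_bound h
      have he := Code.evaln_sound h
      rw [eval_withString_oracle] at he
      have he' : l[n]? = some x := by simpa using he
      simp [evalno, hl _ _ he', Nat.lt_succ_iff.1 hb]
    | pair cf cg hf hg =>
      rw [OCode.withString, Code.evaln] at h; rw [evalno]
      refine hguard (fun h => ?_) h
      simp only [Seq.seq, Option.map_eq_map, Option.mem_def, Option.bind_eq_some_iff,
          Option.map_eq_some_iff, exists_exists_and_eq_and] at h ⊢
      exact h.imp fun a => And.imp (fun h => hf _ _ h) <| Exists.imp fun b =>
        And.imp_left (fun h => hg _ _ h)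
    | comp cf cg hf hg =>
      rw [OCode.withString, Code.evaln] at h; rw [evalno]
      refine hguard (fun h => ?_) h
      simp only [bind, Option.mem_def, Option.bind_eq_some_iff] at h ⊢
      exact h.imp fun a => And.imp (fun h => hg _ _ h) (fun h => hf _ _ h)
    | prec cf cg hf hg =>
      rw [OCode.withString, Code.evaln] at h; rw [evalno]
      refine hguard (fun h => ?_) h
      revert h
      simp only [Nat.unpaired, bind, Option.mem_def]
      cases n.unpair.2 with
      | zero => exact fun h => hf _ _ h
      | succ m =>
        simp only [Option.bind_eq_some_iff]
        rintro ⟨y, h₁, h₂⟩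
        exact ⟨y, evalno_of_evaln (c := .prec cf cg) hl h₁, hg _ _ h₂⟩
    | rfind' cf hf =>
      rw [OCode.withString, Code.evaln] at h; rw [evalno]
      refine hguard (fun h => ?_) h
      simp only [Nat.unpaired, bind, Nat.pair_unpair, Option.pure_def, Option.mem_def,
          Option.bind_eq_some_iff] at h ⊢
      refine h.imp fun y => And.imp (fun h => hf _ _ h) ?_
      by_cases y0 : y = 0
      · simp [y0]
      · simp only [y0, if_false]
        exact fun h => evalno_of_evaln (c := .rfind' cf) hl h

theorem evalo_of_evalno {l : Str} {A : ℕ → ℕ} (hl : ∀ (i x : ℕ), l[i]? = some x → A i = x) :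
    ∀ {k : ℕ} {c : OCode} {n x : ℕ}, x ∈ evalno l k c n → x ∈ evalo A c n
  | 0, _, n, x, h => by simp [evalno] at h
  | k + 1, c, n, x, h => by
    induction c generalizing x n with (
      rw [evalno] at h
      simp only [Option.mem_def, bind, Option.bind_eq_some_iff, Option.guard_eq_some'] at h
      obtain ⟨_, _, h⟩ := h)
    | zero => exact Part.mem_some_iff.2 (Option.some.inj h).symm
    | succ => exact Part.mem_some_iff.2 (Option.some.inj h).symm
    | left => exact Part.mem_some_iff.2 (Option.some.inj h).symm
    | right => exact Part.mem_some_iff.2 (Option.some.inj h).symm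
    | oracle => exact Part.mem_some_iff.2 (hl _ _ h).symm
    | pair cf cg hf hg =>
      simp only [Seq.seq, Option.map_eq_map, Option.bind_eq_some_iff,
          Option.map_eq_some_iff, exists_exists_and_eq_and] at h
      obtain ⟨y, hy, z, hz, rfl⟩ := h
      exact mem_evalo_pair.2 ⟨y, hf _ _ hy, z, hg _ _ hz, rfl⟩
    | comp cf cg hf hg =>
      obtain ⟨y, hy, hx⟩ := h
      exact mem_evalo_comp.2 ⟨y, hg _ _ hy, hf _ _ hx⟩
    | prec cf cg hf hg =>
      obtain ⟨a, m, rfl⟩ : ∃ a m, n = Nat.pair a m := ⟨_, _, (Nat.pair_unpair n).symm⟩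
      simp only [Nat.unpaired, Nat.unpair_pair] at h
      cases m with
      | zero => exact mem_evalo_prec_zero.2 (hf _ _ h)
      | succ m =>
        obtain ⟨y, h₁, h₂⟩ := Option.bind_eq_some_iff.1 h
        exact mem_evalo_prec_succ.2 ⟨y, evalo_of_evalno hl h₁, hg _ _ h₂⟩
    | rfind' cf hf =>
      obtain ⟨a, m, rfl⟩ : ∃ a m, n = Nat.pair a m := ⟨_, _, (Nat.pair_unpair n).symm⟩
      simp only [Nat.unpair_pair] at h
      obtain ⟨y, h₁, h₂⟩ := h
      have hy := hf _ _ h₁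
      rw [mem_evalo_rfind']
      by_cases y0 : y = 0
      · rw [if_pos y0] at h₂
        exact ⟨0, ⟨by simpa [y0] using hy, fun i hi => absurd hi i.not_lt_zero⟩,
          by simpa using h₂⟩
      · rw [if_neg y0] at h₂
        obtain ⟨j, ⟨hj, hlt⟩, rfl⟩ := mem_evalo_rfind'.1 (evalo_of_evalno hl h₂)
        refine ⟨j + 1, ⟨by rwa [Nat.add_right_comm, Nat.add_assoc], fun i hi => ?_⟩, by omega⟩
        cases i with
        | zero => exact ⟨y, by simpa using hy, y0⟩
        | succ i =>
          rw [Nat.add_right_comm, Nat.add_assoc]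
          exact hlt i (by omega)

/-- The use principle: a convergent oracle computation queries only finitely much of the oracle. -/
theorem exists_use {A : ℕ → ℕ} {c : OCode} {n x : ℕ} (h : x ∈ evalo A c n) :
    ∃ b, ∀ l : Str, (∀ i < b, l[i]? = some (A i)) → x ∈ (c.withString l).eval n := by
  simp only [← evalo_ofCode A]
  induction c generalizing n x with
  | zero => exact ⟨0, fun l _ => h⟩
  | succ => exact ⟨0, fun l _ => h⟩
  | left => exact ⟨0, fun l _ => h⟩
  | right => exact ⟨0, fun l _ => h⟩
  | oracle =>
    refine ⟨n + 1, fun l hl => ?_⟩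
    rw [evalo_ofCode, eval_withString_oracle, hl n n.lt_succ_self]
    exact h
  | pair cf cg hf hg =>
    obtain ⟨y, hy, z, hz, rfl⟩ := mem_evalo_pair.1 h
    obtain ⟨b₁, h₁⟩ := hf hy
    obtain ⟨b₂, h₂⟩ := hg hz
    exact ⟨max b₁ b₂, fun l hl => mem_evalo_pair.2
      ⟨y, h₁ l fun i hi => hl i (lt_max_of_lt_left hi), z,
        h₂ l fun i hi => hl i (lt_max_of_lt_right hi), rfl⟩⟩
  | comp cf cg hf hg =>
    obtain ⟨y, hy, hx⟩ := mem_evalo_comp.1 h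
    obtain ⟨b₁, h₁⟩ := hg hy
    obtain ⟨b₂, h₂⟩ := hf hx
    exact ⟨max b₁ b₂, fun l hl => mem_evalo_comp.2
      ⟨y, h₁ l fun i hi => hl i (lt_max_of_lt_left hi),
        h₂ l fun i hi => hl i (lt_max_of_lt_right hi)⟩⟩
  | prec cf cg hf hg =>
    obtain ⟨a, m, rfl⟩ : ∃ a m, n = Nat.pair a m := ⟨_, _, (Nat.pair_unpair n).symm⟩
    induction m generalizing x with
    | zero =>
      obtain ⟨b, hb⟩ := hf (mem_evalo_prec_zero.1 h)
      exact ⟨b, fun l hl => mem_evalo_prec_zero.2 (hb l hl)⟩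
    | succ m ih =>
      obtain ⟨y, hy, hx⟩ := mem_evalo_prec_succ.1 h
      obtain ⟨b₁, h₁⟩ := ih hy
      obtain ⟨b₂, h₂⟩ := hg hx
      exact ⟨max b₁ b₂, fun l hl => mem_evalo_prec_succ.2
        ⟨y, h₁ l fun i hi => hl i (lt_max_of_lt_left hi),
          h₂ l fun i hi => hl i (lt_max_of_lt_right hi)⟩⟩
  | rfind' cf hf =>
    obtain ⟨a, m, rfl⟩ : ∃ a m, n = Nat.pair a m := ⟨_, _, (Nat.pair_unpair n).symm⟩
    obtain ⟨y, ⟨hy, hlt⟩, rfl⟩ := mem_evalo_rfind'.1 h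
    have huse : ∀ i : ℕ, ∃ b, ∀ z ∈ evalo A cf (Nat.pair a (i + m)),
        ∀ l : Str, (∀ j < b, l[j]? = some (A j)) →
          z ∈ evalo A (.ofCode (cf.withString l)) (Nat.pair a (i + m)) := by
      intro i
      by_cases hi : ∃ z, z ∈ evalo A cf (Nat.pair a (i + m))
      · obtain ⟨z, hz⟩ := hi
        obtain ⟨b, hb⟩ := hf hz
        refine ⟨b, fun z' hz' => ?_⟩
        obtain rfl := Part.mem_unique hz hz'
        exact hb
      · exact ⟨0, fun z hz => absurd ⟨z, hz⟩ hi⟩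
    choose b hb using huse
    refine ⟨(Finset.range (y + 1)).sup b, fun l hl => mem_evalo_rfind'.2 ⟨y, ⟨?_, ?_⟩, rfl⟩⟩
    · exact hb y _ hy l fun j hj =>
        hl j (hj.trans_le (Finset.le_sup (Finset.mem_range.2 y.lt_succ_self)))
    · intro i hi
      obtain ⟨z, hz, hz0⟩ := hlt i hi
      exact ⟨z, hb i z hz l fun j hj =>
        hl j (hj.trans_le (Finset.le_sup (Finset.mem_range.2 (hi.trans y.lt_succ_self)))), hz0⟩

theorem primrec₂_withString : Primrec₂ fun (l : Str) (e : ℕ) => (OCode.ofNat e).withString l := by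
  let look : Str × List Code → ℕ → Code := fun p i => p.2.getD i Code.zero
  have hlook : ∀ {f : Str × List Code → ℕ}, Primrec f → Primrec fun p => look p (f p) := fun hf =>
    (Primrec.list_getD Code.zero).comp Primrec.snd hf
  let n : Str × List Code → ℕ := fun p => p.2.length - 5
  have hlen : Primrec fun p : Str × List Code => p.2.length := Primrec.list_length.comp Primrec.snd
  have hn : Primrec n := Primrec.nat_sub.comp hlen (Primrec.const 5)
  have hd : Primrec fun p => (n p).div2.div2 := Primrec.nat_div2.comp (Primrec.nat_div2.comp hn)
  have hl := hlook (Primrec.fst.comp (Primrec.unpair.comp hd))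
  have hr := hlook (Primrec.snd.comp (Primrec.unpair.comp hd))
  let g : Str → List Code → Option Code := fun l t => some <|
    if t.length = 0 then Code.zero
    else if t.length = 1 then Code.succ
    else if t.length = 2 then Code.left
    else if t.length = 3 then Code.right
    else if t.length = 4 then Code.curry lookupCode (Encodable.encode l)
    else bif (n (l, t)).bodd then
      bif (n (l, t)).div2.bodd then Code.rfind' (look (l, t) (n (l, t)).div2.div2)
      else Code.prec (look (l, t) (n (l, t)).div2.div2.unpair.1)
        (look (l, t) (n (l, t)).div2.div2.unpair.2)
    else bif (n (l, t)).div2.bodd then Code.comp (look (l, t) (n (l, t)).div2.div2.unpair.1)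
        (look (l, t) (n (l, t)).div2.div2.unpair.2)
      else Code.pair (look (l, t) (n (l, t)).div2.div2.unpair.1)
        (look (l, t) (n (l, t)).div2.div2.unpair.2)
  have hg : Primrec₂ g := by
    have heq : ∀ k, PrimrecPred fun p : Str × List Code => p.2.length = k := fun k =>
      Primrec.eq.comp hlen (Primrec.const k)
    refine Primrec.option_some.comp <|
      Primrec.ite (heq 0) (Primrec.const _) <| Primrec.ite (heq 1) (Primrec.const _) <|
      Primrec.ite (heq 2) (Primrec.const _) <| Primrec.ite (heq 3) (Primrec.const _) <|
      Primrec.ite (heq 4) (Code.primrec₂_curry.comp (Primrec.const _)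
        (Primrec.encode.comp Primrec.fst)) <|
      Primrec.cond (Primrec.nat_bodd.comp hn)
        (Primrec.cond (Primrec.nat_bodd.comp (Primrec.nat_div2.comp hn))
          (Code.primrec_rfind'.comp (hlook hd)) (Code.primrec₂_prec.comp hl hr))
        (Primrec.cond (Primrec.nat_bodd.comp (Primrec.nat_div2.comp hn))
          (Code.primrec₂_comp.comp hl hr) (Code.primrec₂_pair.comp hl hr))
  refine Primrec.nat_strong_rec _ hg fun l e => ?_
  have hlk : ∀ i < e, look (l, (List.range e).map fun e => (OCode.ofNat e).withString l) i =
      (OCode.ofNat i).withString l := fun i hi => by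
    simp [look, hi]
  match e, hlk with
  | 0, _ => simp [g, OCode.ofNat, OCode.withString]
  | 1, _ => simp [g, OCode.ofNat, OCode.withString]
  | 2, _ => simp [g, OCode.ofNat, OCode.withString]
  | 3, _ => simp [g, OCode.ofNat, OCode.withString]
  | 4, _ => simp [g, OCode.ofNat, OCode.withString]
  | e + 5, hlk =>
    have hm : e.div2.div2 < e + 5 := by
      simp only [Nat.div2_val]
      omega
    have h0 := hlk _ hm
    have h1 := hlk _ ((Nat.unpair_left_le _).trans_lt hm)
    have h2 := hlk _ ((Nat.unpair_right_le _).trans_lt hm)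
    have hne : n (l, (List.range (e + 5)).map fun e => (OCode.ofNat e).withString l) = e := by
      simp [n]
    simp only [g, hne, h0, h1, h2]
    rw [OCode.ofNat]
    cases e.bodd <;> cases e.div2.bodd <;> simp [OCode.withString]

/-! ### Uniform computability relative to a family of oracles -/

/-- The family `f` is computable from the family of oracles `O` by a single code. -/
def UnifComputable {ι α β : Type*} [Primcodable α] [Primcodable β] (O : ι → ℕ → ℕ)
    (f : ι → α → β) : Prop :=
  ∃ c : OCode, ∀ i a, evalo (O i) c (Encodable.encode a) = Part.some (Encodable.encode (f i a))

namespace UnifComputable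

variable {ι α β γ σ : Type*} [Primcodable α] [Primcodable β] [Primcodable γ] [Primcodable σ]
  {O : ι → ℕ → ℕ}

theorem of_eq {f g : ι → α → β} (hf : UnifComputable O f) (h : ∀ i a, f i a = g i a) :
    UnifComputable O g :=
  (funext₂ h : f = g) ▸ hf

theorem of_computable {f : α → β} (hf : Computable f) : UnifComputable O fun _ => f := by
  obtain ⟨c, hc⟩ := Code.exists_code.1 hf
  refine ⟨.ofCode c, fun i a => ?_⟩
  rw [evalo_ofCode, hc]
  simp

theorem oracle : UnifComputable O O :=
  ⟨.oracle, fun _ _ => rfl⟩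

theorem comp {f : ι → β → γ} {g : ι → α → β} (hf : UnifComputable O f)
    (hg : UnifComputable O g) : UnifComputable O fun i a => f i (g i a) := by
  obtain ⟨c, hc⟩ := hf
  obtain ⟨d, hd⟩ := hg
  refine ⟨.comp c d, fun i a => Part.eq_some_iff.2 (mem_evalo_comp.2
    ⟨Encodable.encode (g i a), ?_, ?_⟩)⟩
  · rw [hd]
    exact Part.mem_some _
  · rw [hc]
    exact Part.mem_some _

theorem pair {f : ι → α → β} {g : ι → α → γ} (hf : UnifComputable O f)
    (hg : UnifComputable O g) : UnifComputable O fun i a => (f i a, g i a) := by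
  obtain ⟨c, hc⟩ := hf
  obtain ⟨d, hd⟩ := hg
  exact ⟨.pair c d, fun i a => by simp [evalo, hc, hd, Seq.seq]⟩

theorem comp_computable {f : ι → β → γ} {g : α → β} (hf : UnifComputable O f)
    (hg : Computable g) : UnifComputable O fun i a => f i (g a) :=
  hf.comp (of_computable hg)

theorem computable_comp {f : β → γ} {g : ι → α → β} (hf : Computable f)
    (hg : UnifComputable O g) : UnifComputable O fun i a => f (g i a) :=
  (of_computable hf).comp hg

theorem nat_rec {f : ι → α → σ} {g : ι → α × ℕ × σ → σ} (hf : UnifComputable O f)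
    (hg : UnifComputable O g) : UnifComputable O fun i (p : α × ℕ) =>
      Nat.rec (motive := fun _ => σ) (f i p.1) (fun n s => g i (p.1, n, s)) p.2 := by
  obtain ⟨c, hc⟩ := hf
  obtain ⟨d, hd⟩ := hg
  refine ⟨.prec c d, fun i ⟨a, n⟩ => ?_⟩
  rw [Encodable.encode_prod_val, Encodable.encode_nat, Part.eq_some_iff]
  induction n with
  | zero =>
    rw [mem_evalo_prec_zero, hc]
    exact Part.mem_some _
  | succ n ih =>
    refine mem_evalo_prec_succ.2 ⟨_, ih, ?_⟩
    have := hd i (a, n, Nat.rec (motive := fun _ => σ) (f i a) (fun n s => g i (a, n, s)) n)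
    simp only [Encodable.encode_prod_val, Encodable.encode_nat] at this
    rw [this]
    exact Part.mem_some _

theorem trans {B : ι → ℕ → ℕ} {f : ι → α → β} (hB : UnifComputable O B)
    (hf : UnifComputable B f) : UnifComputable O f := by
  obtain ⟨c, hc⟩ := hB
  obtain ⟨d, hd⟩ := hf
  exact ⟨c.subst d, fun i a => by rw [evalo_subst (B := B i) fun n => hc i n, hd]⟩

theorem exists_rfind {p : ι → α × ℕ → Bool} (hp : UnifComputable O p) :
    ∃ c : OCode, ∀ i a n, n ∈ evalo (O i) c (Encodable.encode a) ↔
      p i (a, n) = true ∧ ∀ m < n, p i (a, m) = false := by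
  obtain ⟨c, hc⟩ : UnifComputable O fun i q => (bif p i q then 0 else 1 : ℕ) :=
    computable_comp (f := fun b => (bif b then 0 else 1 : ℕ)) (Primrec.dom_finite _).to_comp hp
  obtain ⟨d, hd⟩ : UnifComputable O fun _ n => (n, 0) :=
    of_computable (Computable.id.pair (Computable.const (α := ℕ) 0))
  refine ⟨.comp (.rfind' c) d, fun i a n => ?_⟩
  have hd' := hd i (Encodable.encode a)
  simp only [Encodable.encode_prod_val, Encodable.encode_nat] at hd'
  have hc' : ∀ m, evalo (O i) c (Nat.pair (Encodable.encode a) m) =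
      Part.some (bif p i (a, m) then 0 else 1) := fun m => hc i (a, m)
  rw [mem_evalo_comp]
  simp only [hd', Part.mem_some_iff, exists_eq_left, mem_evalo_rfind', Nat.add_zero, hc',
    exists_eq_right]
  refine and_congr ?_ (forall₂_congr fun m _ => ?_)
  · cases p i (a, n) <;> simp
  · cases p i (a, m) <;> simp

theorem search {p : ι → α × ℕ → Bool} (hp : UnifComputable O p) {f : ι → α → ℕ}
    (hf : ∀ i a, p i (a, f i a) = true ∧ ∀ m < f i a, p i (a, m) = false) :
    UnifComputable O f := by
  obtain ⟨c, hc⟩ := hp.exists_rfind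
  exact ⟨c, fun i a => Part.eq_some_iff.2 ((hc i a _).2 (hf i a))⟩

/-- Uniformly `Σ₁` predicates are many-one reducible to the jump, uniformly. -/
theorem exists_jump {p : ι → α × ℕ → Bool} (hp : UnifComputable O p) :
    ∃ q : α → ℕ, Computable q ∧
      ∀ i a, jump (O i) (q a) = if ∃ n, p i (a, n) = true then 1 else 0 := by
  obtain ⟨c, hc⟩ := hp.exists_rfind
  refine ⟨fun a => (OCode.comp c (OCode.const (Encodable.encode a))).index,
    (computable_index_comp_const c).comp Computable.encode, fun i a => ?_⟩
  rw [jump, OCode.ofNat_index]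
  refine if_congr ?_ rfl rfl
  simp only [Part.dom_iff_mem, mem_evalo_comp, evalo_const, Part.mem_some_iff, exists_eq_left, hc]
  refine ⟨fun ⟨n, hn, _⟩ => ⟨n, hn⟩, fun h => ⟨Nat.find h, Nat.find_spec h, fun m hm => ?_⟩⟩
  simpa using Nat.find_min h hm

theorem jump_self : UnifComputable (fun i => jump (O i)) O := by
  have h : UnifComputable O fun i (p : (ℕ × ℕ) × ℕ) => decide (O i p.1.1 = p.1.2) :=
    computable_comp (f := fun p : ℕ × ℕ => decide (p.1 = p.2)) Primrec.eq.decide.to_comp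
      ((oracle.comp_computable (Computable.fst.comp Computable.fst)).pair
        (of_computable (Computable.snd.comp Computable.fst)))
  obtain ⟨q, hq, hj⟩ := h.exists_jump
  have hs : UnifComputable (fun i => jump (O i))
      fun i (p : ℕ × ℕ) => decide (jump (O i) (q p) = 1) :=
    computable_comp (f := fun n : ℕ => decide (n = 1))
      (PrimrecPred.decide (Primrec.eq.comp .id (.const 1))).to_comp (oracle.comp_computable hq)
  refine hs.search fun i n => ?_
  simp only [hj]
  exact ⟨by simp, fun m hm => by simp [hm.ne']⟩

theorem initSeg : UnifComputable O fun i n => initSeg (O i) n := by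
  have h : UnifComputable O fun i (p : Unit × ℕ × Str) => p.2.2 ++ [O i p.2.1] :=
    computable_comp (f := fun p : Str × ℕ => p.1 ++ [p.2]) Computable.list_concat
      ((of_computable (Computable.snd.comp Computable.snd)).pair
        (oracle.comp_computable (Computable.fst.comp Computable.snd)))
  refine (((of_computable (Computable.const ([] : Str))).nat_rec h).comp_computable
    ((Computable.const ()).pair Computable.id)).of_eq fun i n => ?_
  induction n with
  | zero => rfl
  | succ n ih =>
    simp only [id] at ih ⊢
    rw [ih, Harrington.initSeg, Harrington.initSeg, List.range_succ, List.map_append]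
    rfl

theorem oplus_left {B C : ι → ℕ → ℕ} : UnifComputable (fun i => oplus (B i) (C i)) B :=
  (oracle.comp_computable (g := fun n : ℕ => 2 * n) Primrec.nat_double.to_comp).of_eq
    fun i n => by simp [oplus]

theorem oplus_right {B C : ι → ℕ → ℕ} : UnifComputable (fun i => oplus (B i) (C i)) C :=
  (oracle.comp_computable (g := fun n : ℕ => 2 * n + 1)
    (Primrec.succ.comp Primrec.nat_double).to_comp).of_eq
    fun i n => by simp [oplus, Nat.mul_add_div]

theorem oplus {B C : ι → ℕ → ℕ} (hB : UnifComputable O B) (hC : UnifComputable O C) :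
    UnifComputable O fun i => oplus (B i) (C i) := by
  have hh : Computable fun n : ℕ => n / 2 := (Primrec.nat_div.comp .id (.const 2)).to_comp
  have hc : Primrec fun p : ℕ × ℕ × ℕ => if p.1 % 2 = 0 then p.2.1 else p.2.2 :=
    Primrec.ite (Primrec.eq.comp (Primrec.nat_mod.comp .fst (.const 2)) (.const 0))
      (Primrec.fst.comp .snd) (Primrec.snd.comp .snd)
  exact computable_comp hc.to_comp ((of_computable Computable.id).pair
    ((hB.comp_computable hh).pair (hC.comp_computable hh)))

end UnifComputable

/-! ### Halting with a finite part of the oracle -/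

/-- Machine `e` halts on input `e` within `s` steps once its oracle queries are replaced by lookups
in the string `l`. -/
noncomputable def haltsWithin (l : Str) (s e : ℕ) : Bool :=
  (Code.evaln s ((OCode.ofNat e).withString l) e).isSome

theorem primrec_haltsWithin : Primrec fun p : Str × ℕ × ℕ => haltsWithin p.1 p.2.1 p.2.2 :=
  Primrec.option_isSome.comp <| Code.primrec_evaln.comp <|
    ((Primrec.fst.comp .snd).pair
      (primrec₂_withString.comp .fst (Primrec.snd.comp .snd))).pair (Primrec.snd.comp .snd)

theorem isSome_evalno_of_haltsWithin {l l' : Str} {s k e : ℕ} (h : haltsWithin l s e = true)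
    (hl : ∀ (i x : ℕ), l[i]? = some x → l'[i]? = some x) (hk : s ≤ k) :
    (evalno l' k (OCode.ofNat e) e).isSome = true := by
  obtain ⟨x, hx⟩ := Option.isSome_iff_exists.1 h
  exact Option.isSome_iff_exists.2 ⟨x, evalno_of_evaln hl (Code.evaln_mono hk hx)⟩

theorem dom_of_isSome_evalno {l : Str} {A : ℕ → ℕ} {k e : ℕ}
    (h : (evalno l k (OCode.ofNat e) e).isSome = true)
    (hl : ∀ (i x : ℕ), l[i]? = some x → A i = x) : (evalo A (OCode.ofNat e) e).Dom := by
  obtain ⟨x, hx⟩ := Option.isSome_iff_exists.1 h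
  exact Part.dom_iff_mem.2 ⟨x, evalo_of_evalno hl hx⟩

theorem exists_haltsWithin {A : ℕ → ℕ} {e : ℕ} (h : (evalo A (OCode.ofNat e) e).Dom) :
    ∃ b, ∀ l : Str, (∀ i < b, l[i]? = some (A i)) →
      ∃ s₀, ∀ s ≥ s₀, haltsWithin l s e = true := by
  obtain ⟨x, hx⟩ := Part.dom_iff_mem.1 h
  obtain ⟨b, hb⟩ := exists_use hx
  refine ⟨b, fun l hl => ?_⟩
  obtain ⟨s₀, hs₀⟩ := Code.evaln_complete.1 (hb l hl)
  exact ⟨s₀, fun s hs => Option.isSome_iff_exists.2 ⟨x, Code.evaln_mono hs hs₀⟩⟩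

theorem initSeg_getElem? (X : ℕ → ℕ) (n i : ℕ) :
    (initSeg X n)[i]? = if i < n then some (X i) else none := by
  by_cases h : i < n <;> simp [initSeg, h]

/-- Uniformly in the oracle, `A' ≤_T B'` whenever `A ≤_T B`. -/
theorem UnifComputable.jump {ι : Type*} {A B : ι → ℕ → ℕ} (h : UnifComputable B A) :
    UnifComputable (fun i => jump (B i)) fun i => jump (A i) := by
  have hp : UnifComputable B fun i (p : (ℕ × ℕ) × ℕ) =>
      haltsWithin (Harrington.initSeg (A i) p.1.2) p.2 p.1.1 := by
    refine computable_comp (f := fun p : Str × ℕ × ℕ => haltsWithin p.1 p.2.1 p.2.2)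
      primrec_haltsWithin.to_comp (pair ?_ (of_computable (Computable.snd.pair
        (Computable.fst.comp Computable.fst))))
    exact (h.trans UnifComputable.initSeg).comp_computable (Computable.snd.comp Computable.fst)
  have hp' : UnifComputable B fun i (p : ℕ × ℕ) =>
      haltsWithin (Harrington.initSeg (A i) p.2.unpair.1) p.2.unpair.2 p.1 :=
    (hp.comp_computable (g := fun p : ℕ × ℕ => ((p.1, p.2.unpair.1), p.2.unpair.2)) <|
      Primrec.to_comp <| (Primrec.fst.pair (Primrec.fst.comp (Primrec.unpair.comp .snd))).pair
        (Primrec.snd.comp (Primrec.unpair.comp .snd)))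
  obtain ⟨q, hq, hj⟩ := hp'.exists_jump
  refine (oracle.comp_computable hq).of_eq fun i e => ?_
  rw [hj, Harrington.jump]
  refine if_congr ⟨fun ⟨n, hn⟩ => ?_, fun hd => ?_⟩ rfl rfl
  · refine dom_of_isSome_evalno (isSome_evalno_of_haltsWithin hn (fun _ _ h => h) le_rfl) ?_
    intro i x hx
    rw [initSeg_getElem?] at hx
    split_ifs at hx
    exact Option.some.inj hx
  · obtain ⟨b, hb⟩ := exists_haltsWithin hd
    obtain ⟨s, hs⟩ := hb (Harrington.initSeg (A i) b) fun i hi => by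
      rw [initSeg_getElem?, if_pos hi]
    exact ⟨Nat.pair b s, by simpa using hs s le_rfl⟩

theorem strOplus_getElem? (τ : Str) (A : ℕ → ℕ) (i : ℕ) :
    (strOplus τ A)[i]? = if i < 2 * τ.length then
      some (if i % 2 = 0 then τ.getD (i / 2) 0 else A (i / 2)) else none := by
  by_cases h : i < 2 * τ.length <;> simp [strOplus, h]

theorem getElem?_eq_some_of_prefix {τ ρ : Str} (h : τ <+: ρ) {i x : ℕ} (hx : τ[i]? = some x) :
    ρ[i]? = some x := by
  obtain ⟨t, rfl⟩ := h
  rw [List.getElem?_append_left (List.getElem?_eq_some_iff.1 hx).1, hx]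

theorem strOplus_getElem?_of_prefix {τ ρ : Str} (h : τ <+: ρ) (A : ℕ → ℕ) {i x : ℕ}
    (hx : (strOplus τ A)[i]? = some x) : (strOplus ρ A)[i]? = some x := by
  rw [strOplus_getElem?] at hx ⊢
  split_ifs at hx with hi h2
  · have hi' : i / 2 < τ.length := by omega
    rw [if_pos (by have := h.length_le; omega), if_pos h2, ← hx]
    simp only [List.getD_eq_getElem?_getD, List.getElem?_eq_getElem hi',
      getElem?_eq_some_of_prefix h (List.getElem?_eq_getElem hi')]
  · rw [if_pos (by have := h.length_le; omega), if_neg h2, hx]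

theorem strOplus_initSeg_getElem? (Y A : ℕ → ℕ) (n i : ℕ) :
    (strOplus (initSeg Y n) A)[i]? = if i < 2 * n then some (oplus Y A i) else none := by
  rw [strOplus_getElem?]
  have hlen : (initSeg Y n).length = n := by simp [initSeg]
  rw [hlen]
  refine ite_congr rfl (fun hi => ?_) fun _ => rfl
  have hi' : i / 2 < n := by omega
  rw [oplus, List.getD_eq_getElem?_getD, initSeg_getElem?, if_pos hi', Option.getD_some]

theorem unifComputable_strOplus {ι : Type*} {O : ι → ℕ → ℕ} :
    UnifComputable O fun i τ => strOplus τ (O i) := by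
  have h : Primrec fun p : Str × Str => (List.range (2 * p.1.length)).map fun j =>
      if j % 2 = 0 then p.1.getD (j / 2) 0 else p.2.getD (j / 2) 0 := by
    have hd : Primrec fun q : (Str × Str) × ℕ => q.2 / 2 := Primrec.nat_div.comp .snd (.const 2)
    refine Primrec.list_map (Primrec.list_range.comp (Primrec.nat_double.comp
      (Primrec.list_length.comp .fst))) (Primrec.ite (Primrec.eq.comp
        (Primrec.nat_mod.comp .snd (.const 2)) (.const 0)) ?_ ?_)
    · exact (Primrec.list_getD 0).comp (Primrec.fst.comp .fst) hd
    · exact (Primrec.list_getD 0).comp (Primrec.snd.comp .fst) hd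
  refine (UnifComputable.computable_comp h.to_comp ((UnifComputable.of_computable
    Computable.id).pair (UnifComputable.initSeg.comp_computable Computable.list_length))).of_eq
      fun i τ => List.map_congr_left fun j hj => ?_
  have hj' : j / 2 < τ.length := by
    have := List.mem_range.1 hj
    simp only [id] at this
    omega
  simp [initSeg_getElem?, hj']

/-! ### The Friedberg treemap -/

/-- The string coded by a natural number. -/
def decodeStr (n : ℕ) : Str := (Encodable.decode n : Option Str).getD []

theorem computable_decodeStr : Computable decodeStr :=
  Computable.option_getD Computable.decode (Computable.const [])

/-- `w` codes an extension of the string `m.1` and a number of steps witnessing that the `m.2`-th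
machine halts relative to some extension of `m.1`. -/
noncomputable def forces (A : ℕ → ℕ) (m : Str × ℕ) (w : ℕ) : Bool :=
  haltsWithin (strOplus (m.1 ++ decodeStr w.unpair.1) A) w.unpair.2 m.2

/-- The least witness for `forces`, or `0` if there is none. -/
noncomputable def leastWitness (A : ℕ → ℕ) (m : Str × ℕ) : ℕ :=
  if h : ∃ w, forces A m w = true then Nat.find h else 0

/-- Extend the string `m.1` so that the `m.2`-th machine halts, if possible, padding with enough
zeros to bound the running time by the length. -/
noncomputable def forceStep (A : ℕ → ℕ) (m : Str × ℕ) : Str :=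
  if ∃ w, forces A m w = true then
    m.1 ++ (decodeStr (leastWitness A m).unpair.1 ++
      (List.range (leastWitness A m).unpair.2).map fun _ => 0)
  else m.1

/-- The value of the Friedberg treemap at the initial segment of length `n` of `X`. -/
noncomputable def friedbergSeq (A X : ℕ → ℕ) : ℕ → Str
  | 0 => []
  | n + 1 => forceStep A (friedbergSeq A X n ++ [X n], n)

/-- The Friedberg treemap relative to `A`. -/
noncomputable def friedbergMap (A : ℕ → ℕ) (σ : Str) : Str :=
  friedbergSeq A (fun i => σ.getD i 0) σ.length

theorem forces_leastWitness {A : ℕ → ℕ} {m : Str × ℕ} (h : ∃ w, forces A m w = true) :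
    forces A m (leastWitness A m) = true := by
  rw [leastWitness, dif_pos h]
  exact Nat.find_spec h

theorem prefix_forceStep (A : ℕ → ℕ) (m : Str × ℕ) : m.1 <+: forceStep A m := by
  rw [forceStep]
  split_ifs
  · exact List.prefix_append _ _
  · exact List.prefix_rfl

theorem isSome_evalno_forceStep {A : ℕ → ℕ} {m : Str × ℕ} (h : ∃ w, forces A m w = true) :
    (evalno (strOplus (forceStep A m) A) (forceStep A m).length (OCode.ofNat m.2) m.2).isSome =
      true := by
  refine isSome_evalno_of_haltsWithin (forces_leastWitness h)
    (fun i x => strOplus_getElem?_of_prefix ?_ A) ?_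
  · rw [forceStep, if_pos h, ← List.append_assoc]
    exact List.prefix_append _ _
  · rw [forceStep, if_pos h]
    simp only [List.length_append, List.length_map, List.length_range]
    omega

theorem friedbergSeq_congr {A X Z : ℕ → ℕ} {n : ℕ} (h : ∀ i < n, X i = Z i) :
    friedbergSeq A X n = friedbergSeq A Z n := by
  induction n with
  | zero => rfl
  | succ n ih =>
    rw [friedbergSeq, friedbergSeq, ih fun i hi => h i (by omega), h n n.lt_succ_self]

theorem friedbergMap_initSeg (A X : ℕ → ℕ) (n : ℕ) :
    friedbergMap A (initSeg X n) = friedbergSeq A X n := by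
  have hlen : (initSeg X n).length = n := by simp [initSeg]
  rw [friedbergMap, hlen]
  exact friedbergSeq_congr fun i hi => by
    rw [List.getD_eq_getElem?_getD, initSeg_getElem?, if_pos hi, Option.getD_some]

theorem concat_prefix_friedbergSeq (A X : ℕ → ℕ) (n : ℕ) :
    friedbergSeq A X n ++ [X n] <+: friedbergSeq A X (n + 1) :=
  prefix_forceStep A (friedbergSeq A X n ++ [X n], n)

theorem isTreemapOn_friedbergMap (A : ℕ → ℕ) : IsTreemapOn Set.univ (friedbergMap A) := by
  intro σ i _
  have h := concat_prefix_friedbergSeq A (fun j => (σ ++ [i]).getD j 0) σ.length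
  rw [friedbergMap, friedbergMap, List.length_append, List.length_singleton]
  convert h using 2
  · exact friedbergSeq_congr fun j hj => by simp [List.getElem?_append_left hj]
  · simp

theorem friedbergSeq_prefix (A X : ℕ → ℕ) {m n : ℕ} (h : m ≤ n) :
    friedbergSeq A X m <+: friedbergSeq A X n := by
  induction n, h using Nat.le_induction with
  | base => exact List.prefix_rfl
  | succ n _ ih =>
    exact (ih.trans (List.prefix_append _ _)).trans (concat_prefix_friedbergSeq A X n)

theorem le_length_friedbergSeq (A X : ℕ → ℕ) (n : ℕ) : n ≤ (friedbergSeq A X n).length := by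
  induction n with
  | zero => exact Nat.zero_le _
  | succ n ih =>
    have h := (concat_prefix_friedbergSeq A X n).length_le
    rw [List.length_append, List.length_singleton] at h
    omega

theorem pathMap_friedbergMap (A X : ℕ → ℕ) (i : ℕ) :
    pathMap (friedbergMap A) X i = (friedbergSeq A X (i + 1)).getD i 0 := by
  rw [pathMap, friedbergMap_initSeg]

theorem friedbergSeq_getElem? {A X : ℕ → ℕ} {n i : ℕ} (hi : i < (friedbergSeq A X n).length) :
    (friedbergSeq A X n)[i]? = some (pathMap (friedbergMap A) X i) := by
  have hi' : i < (friedbergSeq A X (i + 1)).length := le_length_friedbergSeq A X (i + 1)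
  have h₁ := getElem?_eq_some_of_prefix (friedbergSeq_prefix A X (le_max_left n (i + 1)))
    (List.getElem?_eq_getElem hi)
  have h₂ := getElem?_eq_some_of_prefix (friedbergSeq_prefix A X (le_max_right n (i + 1)))
    (List.getElem?_eq_getElem hi')
  rw [pathMap_friedbergMap, List.getD_eq_getElem?_getD, List.getElem?_eq_getElem hi,
    List.getElem?_eq_getElem hi', Option.getD_some, ← h₁, ← h₂]

theorem friedbergSeq_eq_initSeg (A X : ℕ → ℕ) (n : ℕ) :
    friedbergSeq A X n = initSeg (pathMap (friedbergMap A) X) (friedbergSeq A X n).length := by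
  refine List.ext_getElem? fun i => ?_
  rw [initSeg_getElem?]
  split_ifs with hi
  · exact friedbergSeq_getElem? hi
  · exact List.getElem?_eq_none (not_lt.1 hi)

theorem pathMap_friedbergMap_length (A X : ℕ → ℕ) (n : ℕ) :
    pathMap (friedbergMap A) X (friedbergSeq A X n).length = X n := by
  have h := concat_prefix_friedbergSeq A X n
  have hlt : (friedbergSeq A X n).length < (friedbergSeq A X (n + 1)).length := by
    have := h.length_le
    rw [List.length_append, List.length_singleton] at this
    omega
  refine Option.some.inj ?_
  rw [← friedbergSeq_getElem? hlt]
  exact getElem?_eq_some_of_prefix h (by simp)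

/-- The condition forced at stage `e` decides whether machine `e` halts. -/
theorem dom_iff_exists_forces (A X : ℕ → ℕ) (e : ℕ) :
    (evalo (oplus (pathMap (friedbergMap A) X) A) (OCode.ofNat e) e).Dom ↔
      ∃ w, forces A (friedbergSeq A X e ++ [X e], e) w = true := by
  set Y := pathMap (friedbergMap A) X with hY
  constructor
  · intro h
    obtain ⟨b, hb⟩ := exists_haltsWithin h
    have hpre : friedbergSeq A X e ++ [X e] <+: friedbergSeq A X (max (e + 1) b) :=
      (concat_prefix_friedbergSeq A X e).trans (friedbergSeq_prefix A X (le_max_left _ _))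
    obtain ⟨α, hα⟩ := hpre
    have hlen := (le_max_right (e + 1) b).trans (le_length_friedbergSeq A X (max (e + 1) b))
    rw [friedbergSeq_eq_initSeg A X (max (e + 1) b), ← hY] at hα
    obtain ⟨s, hs⟩ := hb (strOplus (friedbergSeq A X e ++ [X e] ++ α) A) fun i hi => by
      rw [hα, strOplus_initSeg_getElem?, if_pos (by omega)]
    refine ⟨Nat.pair (Encodable.encode α) s, ?_⟩
    simpa [forces, decodeStr] using hs s le_rfl
  · intro h
    refine dom_of_isSome_evalno (isSome_evalno_forceStep h) fun i x hx => ?_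
    have hstep : forceStep A (friedbergSeq A X e ++ [X e], e) =
        initSeg Y (friedbergSeq A X (e + 1)).length := friedbergSeq_eq_initSeg A X (e + 1)
    rw [hstep, strOplus_initSeg_getElem?] at hx
    split_ifs at hx
    exact Option.some.inj hx

section

variable {ι : Type*} {O : ι → ℕ → ℕ} {A : ℕ → ℕ}

theorem unifComputable_forces :
    UnifComputable (fun _ : ι => A) fun _ (p : (Str × ℕ) × ℕ) => forces A p.1 p.2 := by
  have happ : Computable fun p : (Str × ℕ) × ℕ => p.1.1 ++ decodeStr p.2.unpair.1 :=
    Computable.list_append.comp (Computable.fst.comp Computable.fst)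
      (computable_decodeStr.comp (Computable.fst.comp (Primrec.unpair.to_comp.comp Computable.snd)))
  refine UnifComputable.computable_comp (f := fun p : Str × ℕ × ℕ => haltsWithin p.1 p.2.1 p.2.2)
    primrec_haltsWithin.to_comp ((unifComputable_strOplus.comp_computable happ).pair
      (.of_computable (Computable.pair ?_ (Computable.snd.comp Computable.fst))))
  exact Computable.snd.comp (Primrec.unpair.to_comp.comp Computable.snd)

theorem unifComputable_oracle_of_jump (hO : UnifComputable O fun _ => jump A) :
    UnifComputable O fun _ => A :=
  hO.trans UnifComputable.jump_self

theorem unifComputable_exists_forces (hO : UnifComputable O fun _ => jump A) :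
    UnifComputable O fun _ m => decide (∃ w, forces A m w = true) := by
  obtain ⟨q, hq, hj⟩ := (unifComputable_forces (ι := ι) (A := A)).exists_jump
  refine (UnifComputable.computable_comp (f := fun n : ℕ => decide (n = 1))
    (PrimrecPred.decide (Primrec.eq.comp .id (.const 1))).to_comp
    (hO.comp_computable hq)).of_eq fun i m => ?_
  rw [hj i]
  split_ifs with h <;> simp [h]

theorem unifComputable_leastWitness (hO : UnifComputable O fun _ => jump A) :
    UnifComputable O fun _ => leastWitness A := by
  have hp : UnifComputable O fun _ (p : (Str × ℕ) × ℕ) =>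
      !decide (∃ w, forces A p.1 w = true) || forces A p.1 p.2 :=
    UnifComputable.computable_comp (f := fun b : Bool × Bool => !b.1 || b.2)
      (Primrec.dom_finite _).to_comp
      (((unifComputable_exists_forces hO).comp_computable Computable.fst).pair
        ((unifComputable_oracle_of_jump hO).trans unifComputable_forces))
  refine hp.search fun i m => ?_
  by_cases h : ∃ w, forces A m w = true
  · refine ⟨by simp [forces_leastWitness h], fun w hw => ?_⟩
    rw [leastWitness, dif_pos h] at hw
    have := Nat.find_min h hw
    rw [decide_eq_true h]
    simpa using this
  · rw [decide_eq_false h]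
    simp [leastWitness, h]

theorem unifComputable_forceStep (hO : UnifComputable O fun _ => jump A) :
    UnifComputable O fun _ => forceStep A := by
  have hc : Computable fun p : (Str × ℕ) × Bool × ℕ => bif p.2.1 then
      p.1.1 ++ (decodeStr p.2.2.unpair.1 ++ (List.range p.2.2.unpair.2).map fun _ => 0)
      else p.1.1 := by
    have hu : Computable fun p : (Str × ℕ) × Bool × ℕ => p.2.2.unpair :=
      Primrec.unpair.to_comp.comp (Computable.snd.comp Computable.snd)
    have hz : Primrec fun n : ℕ => (List.range n).map fun _ => 0 :=
      Primrec.list_map Primrec.list_range (Primrec.const 0).to₂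
    have hs : Computable fun p : (Str × ℕ) × Bool × ℕ => p.1.1 :=
      Computable.fst.comp Computable.fst
    exact Computable.cond (Computable.fst.comp Computable.snd)
      (Computable.list_append.comp hs (Computable.list_append.comp
        (computable_decodeStr.comp (Computable.fst.comp hu))
        (hz.to_comp.comp (Computable.snd.comp hu)))) hs
  refine (UnifComputable.computable_comp hc ((UnifComputable.of_computable Computable.id).pair
    ((unifComputable_exists_forces hO).pair (unifComputable_leastWitness hO)))).of_eq
      fun i m => ?_
  by_cases h : ∃ w, forces A m w = true
  · simp [forceStep, h]
  · simp [forceStep, h]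

/-- A sequence built by iterating `forceStep` on strings extended by computable entries is
computable. -/
theorem unifComputable_iterate_forceStep {α : Type*} [Primcodable α]
    (hO : UnifComputable O fun _ => jump A) {x : ι → (α × ℕ × Str) → ℕ}
    (hx : UnifComputable O x) :
    UnifComputable O fun i (p : α × ℕ) => Nat.rec (motive := fun _ => Str) []
      (fun n τ => forceStep A (τ ++ [x i (p.1, n, τ)], n)) p.2 := by
  refine (UnifComputable.of_computable (Computable.const ([] : Str))).nat_rec
    ((unifComputable_forceStep hO).comp (g := fun i (q : α × ℕ × Str) => (q.2.2 ++ [x i q], q.2.1))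
      (UnifComputable.pair ?_ (.of_computable (Computable.fst.comp Computable.snd))))
  exact UnifComputable.computable_comp (f := fun p : Str × ℕ => p.1 ++ [p.2])
    Computable.list_concat
    ((UnifComputable.of_computable (Computable.snd.comp Computable.snd)).pair hx)

theorem unifComputable_friedbergSeq {α : Type*} [Primcodable α]
    (hO : UnifComputable O fun _ => jump A) {X : ι → α → ℕ → ℕ}
    (hX : UnifComputable O fun i (p : α × ℕ) => X i p.1 p.2) :
    UnifComputable O fun i (p : α × ℕ) => friedbergSeq A (X i p.1) p.2 := by
  refine (unifComputable_iterate_forceStep hO (x := fun i q => X i q.1 q.2.1)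
    (hX.comp_computable (Computable.fst.pair (Computable.fst.comp Computable.snd)))).of_eq
    fun i ⟨a, n⟩ => ?_
  induction n with
  | zero => rfl
  | succ n ih =>
    simp only [friedbergSeq] at ih ⊢
    rw [ih]

theorem unifComputable_friedbergMap (hO : UnifComputable O fun _ => jump A) :
    UnifComputable O fun _ => friedbergMap A :=
  (unifComputable_friedbergSeq hO (X := fun _ (σ : Str) j => σ.getD j 0)
    (.of_computable (Primrec.list_getD 0).to_comp)).comp_computable
    (Computable.id.pair Computable.list_length)

theorem unifComputable_friedbergSeq_of_path {X : ι → ℕ → ℕ}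
    (hO : UnifComputable O fun _ => jump A) (hX : UnifComputable O X) :
    UnifComputable O fun i => friedbergSeq A (X i) :=
  (unifComputable_friedbergSeq hO (X := fun i (_ : Unit) => X i)
    (hX.comp_computable Computable.snd)).comp_computable
    ((Computable.const ()).pair Computable.id)

theorem unifComputable_pathMap_friedbergMap {X : ι → ℕ → ℕ}
    (hO : UnifComputable O fun _ => jump A) (hX : UnifComputable O X) :
    UnifComputable O fun i => pathMap (friedbergMap A) (X i) :=
  (UnifComputable.computable_comp (f := fun p : Str × ℕ => p.1.getD p.2 0)
    (Primrec.list_getD 0).to_comp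
    (((unifComputable_friedbergSeq_of_path hO hX).comp_computable Computable.succ).pair
      (.of_computable Computable.id))).of_eq fun i n => (pathMap_friedbergMap A (X i) n).symm

theorem unifComputable_friedbergSeq_of_pathMap {X : ι → ℕ → ℕ}
    (hO : UnifComputable O fun _ => jump A)
    (hY : UnifComputable O fun i => pathMap (friedbergMap A) (X i)) :
    UnifComputable O fun i => friedbergSeq A (X i) := by
  refine ((unifComputable_iterate_forceStep hO
    (x := fun i (q : Unit × ℕ × Str) => pathMap (friedbergMap A) (X i) q.2.2.length)
    (hY.comp_computable (Computable.list_length.comp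
      (Computable.snd.comp Computable.snd)))).comp_computable
    ((Computable.const ()).pair Computable.id)).of_eq fun i n => ?_
  induction n with
  | zero => rfl
  | succ n ih =>
    simp only [id, friedbergSeq] at ih ⊢
    rw [ih, pathMap_friedbergMap_length]

theorem unifComputable_of_pathMap_friedbergMap {X : ι → ℕ → ℕ}
    (hO : UnifComputable O fun _ => jump A)
    (hY : UnifComputable O fun i => pathMap (friedbergMap A) (X i)) : UnifComputable O X :=
  (hY.comp (UnifComputable.computable_comp Computable.list_length
    (unifComputable_friedbergSeq_of_pathMap hO hY))).of_eq fun i n =>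
      pathMap_friedbergMap_length A (X i) n

theorem unifComputable_jump_pathMap_friedbergMap {X : ι → ℕ → ℕ}
    (hO : UnifComputable O fun _ => jump A) (hX : UnifComputable O X) :
    UnifComputable O fun i => jump (oplus (pathMap (friedbergMap A) (X i)) A) := by
  have hm : UnifComputable O fun i e => (friedbergSeq A (X i) e ++ [X i e], e) :=
    (UnifComputable.computable_comp (f := fun p : Str × ℕ => p.1 ++ [p.2])
      Computable.list_concat ((unifComputable_friedbergSeq_of_path hO hX).pair hX)).pair
      (.of_computable Computable.id)
  refine (UnifComputable.computable_comp (f := fun b : Bool => (bif b then 1 else 0 : ℕ))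
    (Primrec.dom_finite _).to_comp ((unifComputable_exists_forces hO).comp hm)).of_eq
    fun i e => ?_
  rw [jump, Bool.cond_decide]
  exact if_congr (dom_iff_exists_forces A (X i) e).symm rfl rfl

end

theorem unifEquivOn_of_unifComputable {f g : (ℕ → ℕ) → ℕ → ℕ} (hf : UnifComputable g f)
    (hg : UnifComputable f g) : UnifEquivOn Set.univ f g := by
  obtain ⟨c, hc⟩ := hf
  obtain ⟨d, hd⟩ := hg
  exact ⟨c, d, fun X _ => ⟨hc X, hd X⟩⟩

/-- **Friedberg-style treemap.**  For every `A` there is an `A'`-recursive treemap `G`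
on the full tree `ℕ*` such that `X ⊕ A' ≡_T G(X) ⊕ A' ≡_T (G(X) ⊕ A)'` uniformly in
`X`; moreover for every `e` and `X`, the `e`-th machine with oracle `G(X) ⊕ A` halts on
input `e` iff it halts within `|G(X↾(e+1))|` steps using the oracle string
`G(X↾(e+1)) ⊕ (A restricted accordingly)`. -/
theorem friedberg_treemap (A : ℕ → ℕ) :
    ∃ G : Str → Str,
      IsTreemapOn Set.univ G ∧
      (∃ c : OCode, ∀ σ : Str,
        evalo (jump A) c (Encodable.encode σ) = Part.some (Encodable.encode (G σ))) ∧
      UnifEquivOn Set.univ (fun X => oplus X (jump A))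
        (fun X => oplus (pathMap G X) (jump A)) ∧
      UnifEquivOn Set.univ (fun X => oplus (pathMap G X) (jump A))
        (fun X => jump (oplus (pathMap G X) A)) ∧
      ∀ (e : ℕ) (X : ℕ → ℕ),
        ((evalo (oplus (pathMap G X) A) (OCode.ofNat e) e).Dom ↔
          (evalno (strOplus (G (initSeg X (e + 1))) A) (G (initSeg X (e + 1))).length
              (OCode.ofNat e) e).isSome = true) := by
  refine ⟨friedbergMap A, isTreemapOn_friedbergMap A, ?_, ?_, ?_, fun e X => ?_⟩
  · obtain ⟨c, hc⟩ := unifComputable_friedbergMap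
      (UnifComputable.oracle (O := fun _ : Unit => jump A))
    exact ⟨c, hc ()⟩
  · refine unifEquivOn_of_unifComputable (.oplus ?_ .oplus_right) (.oplus ?_ .oplus_right)
    · exact unifComputable_of_pathMap_friedbergMap .oplus_right .oplus_left
    · exact unifComputable_pathMap_friedbergMap .oplus_right .oplus_left
  · refine unifEquivOn_of_unifComputable
      (.oplus (UnifComputable.jump_self.trans .oplus_left) (.jump .oplus_right)) ?_
    exact unifComputable_jump_pathMap_friedbergMap .oplus_right
      (unifComputable_of_pathMap_friedbergMap .oplus_right .oplus_left)
  · rw [friedbergMap_initSeg]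
    refine ⟨fun h => isSome_evalno_forceStep ((dom_iff_exists_forces A X e).1 h), fun h => ?_⟩
    refine dom_of_isSome_evalno h fun i x hx => ?_
    generalize hn : (friedbergSeq A X (e + 1)).length = n at hx
    rw [friedbergSeq_eq_initSeg A X (e + 1), hn, strOplus_initSeg_getElem?] at hx
    split_ifs at hx
    exact Option.some.inj hx

end Harrington
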